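/- Assume Assumption A0 and let M ∈ ℕ. For every n ≥ 1 with ν̂_n > 1 one has ‖φ̂_n‖²_{H^M_κ(K̂)} ≤ (ĥ₁(M+1)² / (2κ·tanh(κĥ₂))) · ν̂_n^{2M} / √(ν̂_n² − 1). -/

import Mathlib

open MeasureTheory Real Set
open scoped Real Classical ENNReal NNReal

noncomputable section

/-- Partial derivative in the first coordinate. -/
def pd1 (f : ℝ × ℝ → ℂ) : ℝ × ℝ → ℂ := fun x => deriv (fun t => f (t, x.2)) x.1

/-- Partial derivative in the second coordinate. -/
def pd2 (f : ℝ × ℝ → ℂ) : ℝ × ℝ → ℂ := fun x => deriv (fun t => f (x.1, t)) x.2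

/-- Mixed partial derivative `∂₁^i ∂₂^j`. -/
def pdM (i j : ℕ) (f : ℝ × ℝ → ℂ) : ℝ × ℝ → ℂ := pd1^[i] (pd2^[j] f)

/-- Multi-indices of order at most `M`. -/
def idxLe (M : ℕ) : Finset (ℕ × ℕ) :=
  (Finset.range (M + 1) ×ˢ Finset.range (M + 1)).filter fun p => p.1 + p.2 ≤ M

/-- κ-weighted Sobolev inner product of order `M` on `D`. -/
def sobInner (κ : ℝ) (M : ℕ) (D : Set (ℝ × ℝ)) (f g : ℝ × ℝ → ℂ) : ℂ :=
  ∑ p ∈ idxLe M, ((κ : ℂ) ^ (2 * (p.1 + p.2)))⁻¹ *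
    ∫ x in D, pdM p.1 p.2 f x * (starRingEnd ℂ) (pdM p.1 p.2 g x)

/-- Square of the κ-weighted Sobolev norm of order `M` on `D`. -/
def sobNormSq (κ : ℝ) (M : ℕ) (D : Set (ℝ × ℝ)) (f : ℝ × ℝ → ℂ) : ℝ :=
  ∑ p ∈ idxLe M, (κ ^ (2 * (p.1 + p.2)))⁻¹ * ∫ x in D, ‖pdM p.1 p.2 f x‖ ^ 2

/-- κ-weighted Sobolev norm of order `M` on `D`. -/
def sobNorm (κ : ℝ) (M : ℕ) (D : Set (ℝ × ℝ)) (f : ℝ × ℝ → ℂ) : ℝ :=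
  Real.sqrt (sobNormSq κ M D f)

/-- Membership in `H^M_κ(D)` (for pointwise-differentiable representatives). -/
def MemSob (M : ℕ) (D : Set (ℝ × ℝ)) (f : ℝ × ℝ → ℂ) : Prop :=
  ∀ p ∈ idxLe M, IntegrableOn (fun x => ‖pdM p.1 p.2 f x‖ ^ 2) D

/-- `ν̂_n = nπ/(κ ĥ₁)`. -/
def nuHat (κ h1 : ℝ) (n : ℕ) : ℝ := n * π / (κ * h1)

/-- Principal complex square root of a real number. -/
def csqrt (r : ℝ) : ℂ := (r : ℂ) ^ (1 / 2 : ℂ)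

/-- The single-edge Helmholtz mode `φ̂_n` on the reference rectangle. -/
def phiHat (κ h1 h2 : ℝ) (n : ℕ) : ℝ × ℝ → ℂ := fun x =>
  Complex.sin (↑(κ * nuHat κ h1 n) * (x.1 : ℂ)) *
    Complex.sin ((x.2 : ℂ) * (κ : ℂ) * csqrt (1 - nuHat κ h1 n ^ 2)) /
    Complex.sin ((h2 : ℂ) * (κ : ℂ) * csqrt (1 - nuHat κ h1 n ^ 2))

/-- The open reference rectangle `K̂ = (0,ĥ₁) × (0,ĥ₂)`. -/
def Khat (h1 h2 : ℝ) : Set (ℝ × ℝ) := Ioo 0 h1 ×ˢ Ioo 0 h2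

/-- Assumption A0: `κ²` is not a Δ-Neumann eigenvalue of the rectangle with sides `h1, h2`. -/
def A0cond (κ h1 h2 : ℝ) : Prop :=
  ∀ n m : ℕ, κ ^ 2 ≠ (n * π / h1) ^ 2 + (m * π / h2) ^ 2

/-- Distributional (weak) solution of the homogeneous Helmholtz equation on `D`. -/
def WeakHelmholtz (κ : ℝ) (D : Set (ℝ × ℝ)) (u : ℝ × ℝ → ℂ) : Prop :=
  IntegrableOn u D ∧
  ∀ φ : ℝ × ℝ → ℂ, ContDiff ℝ (⊤ : ℕ∞) φ → HasCompactSupport φ → tsupport φ ⊆ D →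
    ∫ x in D, u x * (pdM 2 0 φ x + pdM 0 2 φ x + (κ : ℂ) ^ 2 * φ x) = 0

/-- The trace of `u` on the top edge (at height `h2`). -/
def traceTop (h2 : ℝ) (u : ℝ × ℝ → ℂ) : ℝ → ℂ := fun t => u (t, h2)

/-- The class `S^{N,M}_κ(K̂, ŝ)` of Helmholtz solutions with trace supported on the top edge. -/
structure SLoc (κ h1 h2 : ℝ) (N M : ℕ) (u : ℝ × ℝ → ℂ) : Prop where
  cont : ContinuousOn u (Icc 0 h1 ×ˢ Icc 0 h2)
  mem : MemSob 1 (Khat h1 h2) u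
  helm : WeakHelmholtz κ (Khat h1 h2) u
  left : ∀ y ∈ Icc (0 : ℝ) h2, u (0, y) = 0
  right : ∀ y ∈ Icc (0 : ℝ) h2, u (h1, y) = 0
  bottom : ∀ x ∈ Icc (0 : ℝ) h1, u (x, 0) = 0
  traceReg : ContDiffOn ℝ M (traceTop h2 u) (Icc 0 h1)
  endpt0 : ∀ j < N, iteratedDerivWithin (2 * j) (traceTop h2 u) (Icc 0 h1) 0 = 0
  endpt1 : ∀ j < N, iteratedDerivWithin (2 * j) (traceTop h2 u) (Icc 0 h1) h1 = 0

/-- Square of the trace seminorm `|u|_{H^M_κ(ŝ)}`. -/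
def traceSemiSq (κ h1 h2 : ℝ) (M : ℕ) (u : ℝ × ℝ → ℂ) : ℝ :=
  (κ ^ (2 * M))⁻¹ * ∫ t in (0 : ℝ)..h1, ‖iteratedDerivWithin M (traceTop h2 u) (Icc 0 h1) t‖ ^ 2

/-- The `L²(ŝ)` inner product of traces on the top edge. -/
def traceL2Inner (h1 h2 : ℝ) (u v : ℝ × ℝ → ℂ) : ℂ :=
  ∫ t in (0 : ℝ)..h1, u (t, h2) * (starRingEnd ℂ) (v (t, h2))

/-- The squared `L²(ŝ)` norm of the trace on the top edge. -/
def traceL2Sq (h1 h2 : ℝ) (u : ℝ × ℝ → ℂ) : ℝ :=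
  ∫ t in (0 : ℝ)..h1, ‖u (t, h2)‖ ^ 2


/-- Principal square root of a nonpositive real. -/
lemma csqrt_of_nonpos {r : ℝ} (hr : r ≤ 0) : csqrt r = Complex.I * (√(-r) : ℝ) := by
  unfold csqrt
  have h : ((√(-r) : ℝ) : ℂ) = (-(r : ℂ)) ^ (1 / 2 : ℂ) := by
    rw [Real.sqrt_eq_rpow, Complex.ofReal_cpow (by linarith)]
    push_cast
    rfl
  have h' : Complex.exp (π * Complex.I * (1 / 2 : ℂ)) = Complex.I := by
    rw [show (π : ℂ) * Complex.I * (1 / 2 : ℂ) = π / 2 * Complex.I by ring]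
    exact Complex.exp_pi_div_two_mul_I
  rw [Complex.ofReal_cpow_of_nonpos hr, h', h, mul_comm]

lemma phiHat_eq_of_one_lt {κ h1 h2 : ℝ} {n : ℕ} (hν : 1 < nuHat κ h1 n) :
    phiHat κ h1 h2 n = fun x =>
      ((Real.sin (κ * nuHat κ h1 n * x.1) : ℝ) : ℂ) *
        ((Real.sinh (κ * √(nuHat κ h1 n ^ 2 - 1) * x.2) /
          Real.sinh (κ * √(nuHat κ h1 n ^ 2 - 1) * h2) : ℝ) : ℂ) := by
  have hr : 1 - nuHat κ h1 n ^ 2 ≤ 0 := by nlinarith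
  funext x
  unfold phiHat
  rw [csqrt_of_nonpos hr, show -(1 - nuHat κ h1 n ^ 2) = nuHat κ h1 n ^ 2 - 1 by ring]
  set s := √(nuHat κ h1 n ^ 2 - 1)
  have hs (y : ℝ) : Complex.sin ((y : ℂ) * κ * (Complex.I * (s : ℝ))) =
      Complex.sinh (κ * s * y) * Complex.I := by
    rw [← Complex.sin_mul_I]
    congr 1
    ring
  rw [hs, hs]
  push_cast
  rw [mul_div_assoc, mul_div_mul_right _ _ Complex.I_ne_zero]

/-- Mixed partial derivatives of a function with separated variables. -/
lemma pdM_mul (i j : ℕ) (F G : ℝ → ℂ) :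
    pdM i j (fun x => F x.1 * G x.2) = fun x => deriv^[i] F x.1 * deriv^[j] G x.2 := by
  have hG : pd2^[j] (fun x => F x.1 * G x.2) = fun x => F x.1 * deriv^[j] G x.2 := by
    induction j with
    | zero => rfl
    | succ j ih =>
      rw [Function.iterate_succ_apply', ih, Function.iterate_succ_apply']
      funext x
      simp [pd2]
  unfold pdM
  rw [hG]
  induction i with
  | zero => rfl
  | succ i ih =>
    rw [Function.iterate_succ_apply', ih, Function.iterate_succ_apply']
    funext x
    simp [pd1]

lemma iterate_deriv_sin_mul (A : ℝ) (i : ℕ) :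
    deriv^[i] (fun t : ℝ => ((Real.sin (A * t) : ℝ) : ℂ)) =
      fun t => ((A ^ i * Real.sin (A * t + i * (π / 2)) : ℝ) : ℂ) := by
  induction i with
  | zero => simp
  | succ i ih =>
    rw [Function.iterate_succ_apply', ih]
    funext t
    have h : HasDerivAt (fun t : ℝ => A ^ i * Real.sin (A * t + i * (π / 2)))
        (A ^ i * (Real.cos (A * t + i * (π / 2)) * (A * 1))) t :=
      ((((hasDerivAt_id t).const_mul A).add_const _).sin).const_mul _
    rw [h.ofReal_comp.deriv]
    congr 1
    push_cast
    rw [add_mul, ← add_assoc, one_mul, Real.sin_add_pi_div_two]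
    ring

lemma iterate_deriv_sinh_mul_div (a d : ℝ) (j : ℕ) :
    deriv^[j] (fun t : ℝ => ((Real.sinh (a * t) / d : ℝ) : ℂ)) =
      fun t => ((a ^ j * (if Even j then Real.sinh (a * t) else Real.cosh (a * t)) / d : ℝ) : ℂ) := by
  induction j with
  | zero => simp
  | succ j ih =>
    rw [Function.iterate_succ_apply', ih]
    funext t
    have h : HasDerivAt
        (fun t : ℝ => a ^ j * (if Even j then Real.sinh (a * t) else Real.cosh (a * t)) / d)
        (a ^ (j + 1) *
          (if Even (j + 1) then Real.sinh (a * t) else Real.cosh (a * t)) / d) t := by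
      have hl : HasDerivAt (fun t : ℝ => a * t) (a * 1) t := (hasDerivAt_id t).const_mul a
      by_cases hj : Even j
      · simp only [hj, Nat.even_add_one, not_true, if_true, if_false]
        refine HasDerivAt.congr_deriv ((hl.sinh.const_mul (a ^ j)).div_const d) ?_
        ring
      · simp only [hj, Nat.even_add_one, not_false_eq_true, if_true, if_false]
        refine HasDerivAt.congr_deriv ((hl.cosh.const_mul (a ^ j)).div_const d) ?_
        ring
    exact h.ofReal_comp.deriv

/-- Over a whole number of half-periods a squared sine has mean `1 / 2`. -/
lemma integral_sin_sq_half_periods {A h : ℝ} (hA : A ≠ 0) {n : ℕ} (hAh : A * h = n * π) (θ : ℝ) :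
    ∫ t in (0 : ℝ)..h, Real.sin (A * t + θ) ^ 2 = h / 2 := by
  have hd : ∀ t ∈ uIcc 0 h, HasDerivAt
      (fun t : ℝ => t / 2 - Real.sin (2 * (A * t + θ)) / (4 * A)) (Real.sin (A * t + θ) ^ 2) t := by
    intro t _
    have hl : HasDerivAt (fun t : ℝ => 2 * (A * t + θ)) (2 * (A * 1)) t :=
      (((hasDerivAt_id t).const_mul A).add_const θ).const_mul 2
    refine HasDerivAt.congr_deriv (((hasDerivAt_id t).div_const 2).sub (hl.sin.div_const (4 * A))) ?_
    rw [Real.cos_two_mul, Real.cos_sq']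
    field_simp
    ring
  rw [intervalIntegral.integral_eq_sub_of_hasDerivAt hd
    (Continuous.intervalIntegrable (by fun_prop) _ _), hAh,
    show 2 * (n * π + θ) = 2 * θ + n * (2 * π) by ring, Real.sin_add_nat_mul_two_pi]
  ring_nf

lemma integral_sinh_sq {a : ℝ} (ha : a ≠ 0) (h : ℝ) :
    ∫ t in (0 : ℝ)..h, Real.sinh (a * t) ^ 2 =
      (Real.sinh (a * h) * Real.cosh (a * h) - a * h) / (2 * a) := by
  have hd : ∀ t ∈ uIcc 0 h, HasDerivAt
      (fun t : ℝ => (Real.sinh (a * t) * Real.cosh (a * t) - a * t) / (2 * a))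
      (Real.sinh (a * t) ^ 2) t := by
    intro t _
    have hl : HasDerivAt (fun t : ℝ => a * t) (a * 1) t := (hasDerivAt_id t).const_mul a
    refine HasDerivAt.congr_deriv (((hl.sinh.mul hl.cosh).sub hl).div_const (2 * a)) ?_
    field_simp
    linarith [Real.cosh_sq (a * t)]
  rw [intervalIntegral.integral_eq_sub_of_hasDerivAt hd
    (Continuous.intervalIntegrable (by fun_prop) _ _)]
  simp

lemma integral_cosh_sq {a : ℝ} (ha : a ≠ 0) (h : ℝ) :
    ∫ t in (0 : ℝ)..h, Real.cosh (a * t) ^ 2 =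
      (Real.sinh (a * h) * Real.cosh (a * h) + a * h) / (2 * a) := by
  have hd : ∀ t ∈ uIcc 0 h, HasDerivAt
      (fun t : ℝ => (Real.sinh (a * t) * Real.cosh (a * t) + a * t) / (2 * a))
      (Real.cosh (a * t) ^ 2) t := by
    intro t _
    have hl : HasDerivAt (fun t : ℝ => a * t) (a * 1) t := (hasDerivAt_id t).const_mul a
    refine HasDerivAt.congr_deriv (((hl.sinh.mul hl.cosh).add hl).div_const (2 * a)) ?_
    field_simp
    linarith [Real.cosh_sq (a * t)]
  rw [intervalIntegral.integral_eq_sub_of_hasDerivAt hd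
    (Continuous.intervalIntegrable (by fun_prop) _ _)]
  simp

lemma tanh_pos_of_pos {x : ℝ} (hx : 0 < x) : 0 < Real.tanh x := by
  rw [Real.tanh_eq_sinh_div_cosh]
  exact div_pos (Real.sinh_pos_iff.2 hx) (Real.cosh_pos x)

/-- A consequence of the concavity of `tanh` on `[0, ∞)`. -/
lemma mul_tanh_le_tanh_mul {s c : ℝ} (hs0 : 0 ≤ s) (hs1 : s ≤ 1) (hc : 0 ≤ c) :
    s * Real.tanh c ≤ Real.tanh (s * c) := by
  have hd (t : ℝ) : HasDerivAt
      (fun t => Real.sinh (s * t) * Real.cosh t - s * (Real.sinh t * Real.cosh (s * t)))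
      ((1 - s ^ 2) * (Real.sinh (s * t) * Real.sinh t)) t := by
    have hl : HasDerivAt (fun t : ℝ => s * t) (s * 1) t := (hasDerivAt_id t).const_mul s
    refine HasDerivAt.congr_deriv ((hl.sinh.mul (Real.hasDerivAt_cosh t)).sub
      (((Real.hasDerivAt_sinh t).mul hl.cosh).const_mul s)) ?_
    ring
  have hmono := monotoneOn_of_hasDerivWithinAt_nonneg (convex_Ici (0 : ℝ))
    (fun t _ => (hd t).continuousAt.continuousWithinAt) (fun t _ => (hd t).hasDerivWithinAt)
    (fun t ht => by
      have ht0 : 0 ≤ t := interior_subset ht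
      exact mul_nonneg (by nlinarith) (mul_nonneg
        (Real.sinh_nonneg_iff.2 (mul_nonneg hs0 ht0)) (Real.sinh_nonneg_iff.2 ht0)))
  have h := hmono self_mem_Ici (mem_Ici.2 hc) hc
  simp only [mul_zero, Real.sinh_zero, zero_mul, sub_zero] at h
  rw [Real.tanh_eq_sinh_div_cosh, Real.tanh_eq_sinh_div_cosh, ← mul_div_assoc,
    div_le_div_iff₀ (Real.cosh_pos _) (Real.cosh_pos _)]
  linarith

lemma tanh_le_tanh_of_le {x y : ℝ} (hxy : x ≤ y) : Real.tanh x ≤ Real.tanh y := by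
  rw [Real.tanh_eq_sinh_div_cosh, Real.tanh_eq_sinh_div_cosh,
    div_le_div_iff₀ (Real.cosh_pos _) (Real.cosh_pos _)]
  have h := Real.sinh_nonneg_iff.2 (sub_nonneg.2 hxy)
  rw [Real.sinh_sub] at h
  linarith

lemma pow_mul_tanh_le {s ν c : ℝ} (hs : 0 ≤ s) (hsν : s ≤ ν) (hν : 1 ≤ ν) (hc : 0 ≤ c) {k : ℕ}
    (hk : k ≠ 0) : s ^ k * Real.tanh c ≤ ν ^ k * Real.tanh (s * c) := by
  have htc : 0 ≤ Real.tanh c := by simpa using tanh_le_tanh_of_le hc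
  rcases le_total s 1 with h | h
  · have hm := mul_tanh_le_tanh_mul hs h hc
    calc s ^ k * Real.tanh c ≤ s * Real.tanh c := by gcongr; exact pow_le_of_le_one hs h hk
      _ ≤ 1 * Real.tanh (s * c) := by rwa [one_mul]
      _ ≤ ν ^ k * Real.tanh (s * c) :=
        mul_le_mul_of_nonneg_right (one_le_pow₀ hν) (le_trans (by positivity) hm)
  · have hm : Real.tanh c ≤ Real.tanh (s * c) := tanh_le_tanh_of_le (by nlinarith)
    gcongr

lemma sinh_mul_cosh_sub_le_sinh_sq (b : ℝ) :
    Real.sinh b * Real.cosh b - b ≤ Real.sinh b ^ 2 := by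
  have h := Real.add_one_le_exp (-(2 * b))
  have h1 : Real.exp b * Real.exp (-b) = 1 := by rw [← Real.exp_add]; simp
  have h2 : Real.exp (-(2 * b)) = Real.exp (-b) ^ 2 := by rw [← Real.exp_nat_mul]; ring_nf
  rw [Real.sinh_eq, Real.cosh_eq]
  nlinarith

lemma integral_iterate_deriv_le {κ s ν h : ℝ} (hκ : 0 < κ) (hs : 0 < s) (hsν : s ≤ ν)
    (hν : 1 ≤ ν) (hh : 0 < h) (j : ℕ) :
    s ^ (2 * j) * (∫ y in (0 : ℝ)..h,
        (if Even j then Real.sinh (κ * s * y) else Real.cosh (κ * s * y)) ^ 2) /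
          Real.sinh (κ * s * h) ^ 2 ≤
      ν ^ (2 * j) / (κ * s * Real.tanh (κ * h)) := by
  have ha : 0 < κ * s := by positivity
  have hb : 0 < κ * s * h := by positivity
  have hS := Real.sinh_pos_iff.2 hb
  have hT := tanh_pos_of_pos (mul_pos hκ hh)
  have hν0 : 0 ≤ ν := by linarith
  have hSC : κ * s * h ≤ Real.sinh (κ * s * h) * Real.cosh (κ * s * h) :=
    (Real.self_le_sinh_iff.2 hb.le).trans (le_mul_of_one_le_right hS.le (Real.one_le_cosh _))
  by_cases hj : Even j
  · simp only [hj, if_true]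
    rw [integral_sinh_sq ha.ne', div_le_div_iff₀ (by positivity) (by positivity)]
    have h1 : (Real.sinh (κ * s * h) * Real.cosh (κ * s * h) - κ * s * h) / (2 * (κ * s)) ≤
        Real.sinh (κ * s * h) ^ 2 / (κ * s) := by
      rw [div_le_div_iff₀ (by positivity) ha]
      nlinarith [mul_le_mul_of_nonneg_right (sinh_mul_cosh_sub_le_sinh_sq (κ * s * h)) ha.le,
        mul_pos (pow_pos hS 2) ha]
    calc _ ≤ ν ^ (2 * j) * (Real.sinh (κ * s * h) ^ 2 / (κ * s)) * (κ * s * Real.tanh (κ * h)) := by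
          gcongr
      _ = ν ^ (2 * j) * Real.sinh (κ * s * h) ^ 2 * Real.tanh (κ * h) := by field_simp
      _ ≤ ν ^ (2 * j) * Real.sinh (κ * s * h) ^ 2 * 1 := by
          gcongr
          exact (Real.tanh_lt_one _).le
      _ = _ := mul_one _
  · simp only [hj, if_false]
    have hj0 : 2 * j ≠ 0 := by
      rintro h0
      exact hj (by simp [show j = 0 by omega])
    have hpow := pow_mul_tanh_le hs.le hsν hν (mul_pos hκ hh).le hj0
    rw [show s * (κ * h) = κ * s * h by ring, Real.tanh_eq_sinh_div_cosh (κ * s * h),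
      ← mul_div_assoc, le_div_iff₀ (Real.cosh_pos _)] at hpow
    have h1 : (Real.sinh (κ * s * h) * Real.cosh (κ * s * h) + κ * s * h) / (2 * (κ * s)) ≤
        Real.sinh (κ * s * h) * Real.cosh (κ * s * h) / (κ * s) := by
      rw [div_le_div_iff₀ (by positivity) ha]
      nlinarith [mul_le_mul_of_nonneg_right hSC ha.le]
    rw [integral_cosh_sq ha.ne', div_le_div_iff₀ (by positivity) (by positivity)]
    calc _ ≤ s ^ (2 * j) * (Real.sinh (κ * s * h) * Real.cosh (κ * s * h) / (κ * s)) *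
            (κ * s * Real.tanh (κ * h)) := by gcongr
      _ = s ^ (2 * j) * Real.tanh (κ * h) * Real.cosh (κ * s * h) * Real.sinh (κ * s * h) := by
          field_simp
      _ ≤ ν ^ (2 * j) * Real.sinh (κ * s * h) * Real.sinh (κ * s * h) := by gcongr
      _ = _ := by ring

/-- The squared `L²` norm of a mixed derivative of an evanescent mode. -/
lemma integral_norm_pdM_phiHat_sq {κ h1 h2 : ℝ} (hκ : 0 < κ) (hh1 : 0 < h1) (hh2 : 0 < h2)
    {n : ℕ} (hν : 1 < nuHat κ h1 n) (i j : ℕ) :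
    ∫ x in Khat h1 h2, ‖pdM i j (phiHat κ h1 h2 n) x‖ ^ 2 =
      (κ * nuHat κ h1 n) ^ (2 * i) * (h1 / 2) *
        ((κ * √(nuHat κ h1 n ^ 2 - 1)) ^ (2 * j) *
          (∫ y in (0 : ℝ)..h2, (if Even j then Real.sinh (κ * √(nuHat κ h1 n ^ 2 - 1) * y)
            else Real.cosh (κ * √(nuHat κ h1 n ^ 2 - 1) * y)) ^ 2) /
          Real.sinh (κ * √(nuHat κ h1 n ^ 2 - 1) * h2) ^ 2) := by
  rw [phiHat_eq_of_one_lt hν]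
  set ν := nuHat κ h1 n with hνdef
  set s := √(ν ^ 2 - 1)
  have hA : κ * ν ≠ 0 := (mul_pos hκ (by linarith)).ne'
  have hAh : κ * ν * h1 = n * π := by
    rw [hνdef, nuHat]
    field_simp
  rw [pdM_mul i j (fun t : ℝ => ((Real.sin (κ * ν * t) : ℝ) : ℂ))
    (fun t : ℝ => ((Real.sinh (κ * s * t) / Real.sinh (κ * s * h2) : ℝ) : ℂ)),
    iterate_deriv_sin_mul, iterate_deriv_sinh_mul_div]
  have hsep (x : ℝ × ℝ) :
      ‖(((κ * ν) ^ i * Real.sin (κ * ν * x.1 + i * (π / 2)) : ℝ) : ℂ) *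
        (((κ * s) ^ j * (if Even j then Real.sinh (κ * s * x.2) else Real.cosh (κ * s * x.2)) /
          Real.sinh (κ * s * h2) : ℝ) : ℂ)‖ ^ 2 =
      (κ * ν) ^ (2 * i) * (κ * s) ^ (2 * j) / Real.sinh (κ * s * h2) ^ 2 *
        (Real.sin (κ * ν * x.1 + i * (π / 2)) ^ 2 *
          (if Even j then Real.sinh (κ * s * x.2) else Real.cosh (κ * s * x.2)) ^ 2) := by
    rw [norm_mul, mul_pow, Complex.norm_real, Complex.norm_real, Real.norm_eq_abs,
      Real.norm_eq_abs, sq_abs, sq_abs]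
    ring
  simp only [hsep]
  rw [integral_const_mul]
  unfold Khat
  rw [Measure.volume_eq_prod, setIntegral_prod_mul
    (fun t : ℝ => Real.sin (κ * ν * t + i * (π / 2)) ^ 2)
    (fun t : ℝ => (if Even j then Real.sinh (κ * s * t) else Real.cosh (κ * s * t)) ^ 2),
    ← integral_Ioc_eq_integral_Ioo, ← integral_Ioc_eq_integral_Ioo,
    ← intervalIntegral.integral_of_le hh1.le, ← intervalIntegral.integral_of_le hh2.le,
    integral_sin_sq_half_periods hA hAh]
  ring

/-- Lemma 2.4, evanescent bound: under Assumption A0, for every evanescent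
mode (`ν̂_n > 1`) one has
`‖φ̂_n‖²_{H^M_κ(K̂)} ≤ (ĥ₁(M+1)²/(2κ tanh(κĥ₂))) · ν̂_n^{2M}/√(ν̂_n²−1)`. -/
theorem evanescent_mode_bound (κ h1 h2 : ℝ) (hκ : 0 < κ) (hh1 : 0 < h1) (hh2 : 0 < h2)
    (hA0 : A0cond κ h1 h2) (M : ℕ) :
    ∀ n : ℕ, 1 ≤ n → 1 < nuHat κ h1 n →
      sobNormSq κ M (Khat h1 h2) (phiHat κ h1 h2 n) ≤
        (h1 * (M + 1) ^ 2 / (2 * κ * Real.tanh (κ * h2))) *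
          (nuHat κ h1 n ^ (2 * M) / Real.sqrt (nuHat κ h1 n ^ 2 - 1)) := by
  intro n _ hν
  have hν0 : 0 < nuHat κ h1 n := by linarith
  have hs : 0 < √(nuHat κ h1 n ^ 2 - 1) := Real.sqrt_pos.2 (by nlinarith)
  have hsν : √(nuHat κ h1 n ^ 2 - 1) ≤ nuHat κ h1 n := Real.sqrt_le_iff.2 ⟨hν0.le, by linarith⟩
  have hT := tanh_pos_of_pos (mul_pos hκ hh2)
  unfold sobNormSq
  have hterm : ∀ p ∈ idxLe M, (κ ^ (2 * (p.1 + p.2)))⁻¹ *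
      ∫ x in Khat h1 h2, ‖pdM p.1 p.2 (phiHat κ h1 h2 n) x‖ ^ 2 ≤
        h1 / (2 * κ * Real.tanh (κ * h2)) *
          (nuHat κ h1 n ^ (2 * M) / √(nuHat κ h1 n ^ 2 - 1)) := by
    rintro ⟨i, j⟩ hp
    have hij : i + j ≤ M := (Finset.mem_filter.1 hp).2
    rw [integral_norm_pdM_phiHat_sq hκ hh1 hh2 hν]
    have key := integral_iterate_deriv_le hκ hs hsν hν.le hh2 j
    set ν := nuHat κ h1 n
    set s := √(ν ^ 2 - 1)
    set J := ∫ y in (0 : ℝ)..h2,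
      (if Even j then Real.sinh (κ * s * y) else Real.cosh (κ * s * y)) ^ 2
    calc _ = ν ^ (2 * i) * (h1 / 2) * (s ^ (2 * j) * J / Real.sinh (κ * s * h2) ^ 2) := by
          rw [mul_add, pow_add, mul_pow, mul_pow]
          field_simp
      _ ≤ ν ^ (2 * i) * (h1 / 2) * (ν ^ (2 * j) / (κ * s * Real.tanh (κ * h2))) := by gcongr
      _ = h1 / (2 * κ * Real.tanh (κ * h2)) * (ν ^ (2 * (i + j)) / s) := by
          rw [mul_add, pow_add]
          field_simp
      _ ≤ _ := by
          gcongr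
          exact hν.le
  have hcard : ((idxLe M).card : ℝ) ≤ ((M : ℝ) + 1) ^ 2 := by
    have h : (idxLe M).card ≤ (M + 1) * (M + 1) := by
      simpa [idxLe] using Finset.card_filter_le (Finset.range (M + 1) ×ˢ Finset.range (M + 1))
        (fun p => p.1 + p.2 ≤ M)
    rw [sq]
    exact_mod_cast h
  refine (Finset.sum_le_card_nsmul _ _ _ hterm).trans ?_
  rw [nsmul_eq_mul]
  refine (mul_le_mul_of_nonneg_right hcard (by positivity)).trans_eq ?_
  ring

end
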